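/- The disjoint union of two copies of the double ray ℤ is (2S_1, ℤ)-minimal, where 2S_1 is the disjoint union of two single edges and ℤ is the double ray. -/

import Mathlib

open SimpleGraph

universe u v w x

/-- A monochromatic copy: `col = true` means red, `col = false` means blue.
There is a copy of `G` in `F` all of whose edges get color `col` under `c`. -/
def HasMonoCopy {α β : Type*} (F : SimpleGraph α) (c : Sym2 α → Bool) (col : Bool)
    (G : SimpleGraph β) : Prop :=
  ∃ f : β → α, Function.Injective f ∧
    ∀ ⦃x y⦄, G.Adj x y → F.Adj (f x) (f y) ∧ c s(f x, f y) = col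

/-- `F → (G,H)`: every red-blue edge coloring of `F` yields a red `G` or a blue `H`. -/
def Arrows {α β γ : Type*} (F : SimpleGraph α) (G : SimpleGraph β) (H : SimpleGraph γ) : Prop :=
  ∀ c : Sym2 α → Bool, HasMonoCopy F c true G ∨ HasMonoCopy F c false H

/-- A `(G,H)`-good coloring of `F`: neither a red copy of `G` nor a blue copy of `H`. -/
def GoodColoring {α β γ : Type*} (F : SimpleGraph α) (G : SimpleGraph β) (H : SimpleGraph γ)
    (c : Sym2 α → Bool) : Prop :=
  ¬ HasMonoCopy F c true G ∧ ¬ HasMonoCopy F c false H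

/-- `F` is `(G,H)`-minimal: `F → (G,H)` but no proper subgraph of `F` arrows `(G,H)`. -/
def IsRamseyMinimal {α β γ : Type*} (F : SimpleGraph α) (G : SimpleGraph β)
    (H : SimpleGraph γ) : Prop :=
  Arrows F G H ∧ ∀ F' : F.Subgraph, F' ≠ ⊤ → ¬ Arrows F'.coe G H

/-- `G` embeds into `H` (as a, not necessarily induced, subgraph). -/
def Embeds {α β : Type*} (G : SimpleGraph α) (H : SimpleGraph β) : Prop :=
  ∃ f : α → β, Function.Injective f ∧ ∀ ⦃x y⦄, G.Adj x y → H.Adj (f x) (f y)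

/-- `G` is self-embeddable: it is isomorphic to a proper subgraph of itself. -/
def SelfEmbeddable {α : Type*} (G : SimpleGraph α) : Prop :=
  ∃ G' : G.Subgraph, G' ≠ ⊤ ∧ Nonempty (G ≃g G'.coe)

/-- A graph is leafless if no vertex has exactly one neighbor. -/
def Leafless {α : Type*} (G : SimpleGraph α) : Prop :=
  ∀ v : α, ¬ ∃! w, G.Adj v w

/-- `G` is a star `K_{1,κ}` (κ ≥ 1): a center adjacent to every other vertex,
every edge meets the center, and there is at least one other vertex. -/
def IsStar {α : Type*} (G : SimpleGraph α) : Prop :=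
  ∃ c : α, (∃ v, v ≠ c) ∧ (∀ v, v ≠ c → G.Adj c v) ∧ ∀ ⦃x y⦄, G.Adj x y → x = c ∨ y = c

/-- A star forest: every connected component is a star. -/
def IsStarForest {α : Type*} (G : SimpleGraph α) : Prop :=
  ∀ C : G.ConnectedComponent, IsStar (G.induce C.supp)

/-- The star `S_n` with `n` edges: center `none`, leaves `some i`. -/
def starGraph (n : ℕ) : SimpleGraph (Option (Fin n)) :=
  SimpleGraph.fromRel fun a b => a = none ∨ b = none

/-- Disjoint union of two graphs. -/
def sumGraph {α β : Type*} (G : SimpleGraph α) (H : SimpleGraph β) : SimpleGraph (α ⊕ β) :=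
  SimpleGraph.fromRel fun a b =>
    match a, b with
    | Sum.inl a, Sum.inl b => G.Adj a b
    | Sum.inr a, Sum.inr b => H.Adj a b
    | _, _ => False

/-- Disjoint union of a family of graphs. -/
def sigmaGraph {ι : Type*} {V : ι → Type*} (G : ∀ i, SimpleGraph (V i)) :
    SimpleGraph (Σ i, V i) :=
  SimpleGraph.fromRel fun a b => ∃ h : a.1 = b.1, (G b.1).Adj (h ▸ a.2) b.2

/-- The double ray (two-way infinite path). -/
def doubleRay : SimpleGraph ℤ := SimpleGraph.fromRel fun a b => b = a + 1

/-- The ray (one-way infinite path). -/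
def rayGraph : SimpleGraph ℕ := SimpleGraph.fromRel fun a b => b = a + 1

/-- `2S_1`: a matching with two edges. -/
def twoS1 : SimpleGraph (Fin 2 ⊕ Fin 2) :=
  sumGraph (⊤ : SimpleGraph (Fin 2)) (⊤ : SimpleGraph (Fin 2))

/-- `kℤ`: the disjoint union of `k` double rays. -/
def nZ (k : ℕ) : SimpleGraph (Σ _ : Fin k, ℤ) :=
  sigmaGraph fun _ : Fin k => doubleRay

/-- The 4-cycle. -/
def cycle4 : SimpleGraph (ZMod 4) := SimpleGraph.fromRel fun a b => b = a + 1

/-- The subdivision graph `S(G)`: each edge of `G` gets a new subdividing vertex. -/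
def subdivision {α : Type*} (G : SimpleGraph α) : SimpleGraph (α ⊕ G.edgeSet) :=
  SimpleGraph.fromRel fun a b =>
    match a, b with
    | Sum.inl v, Sum.inr e => v ∈ (e : Sym2 α)
    | _, _ => False

/-- The graph `Γ(K,A,n)`: to each `u ∈ A` of (finite) degree `m` we add `m·(n-1)` new
clones of `u`, each joined to precisely the neighbors of `u` in `K`. -/
def Gamma {α : Type*} (K : SimpleGraph α) (A : Set α) (n : ℕ) :
    SimpleGraph (α ⊕ Σ u : A, Fin ((K.neighborSet (u : α)).ncard * (n - 1))) :=
  SimpleGraph.fromRel fun a b =>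
    match a, b with
    | Sum.inl x, Sum.inl y => K.Adj x y
    | Sum.inl x, Sum.inr p => K.Adj (p.1 : α) x
    | _, _ => False

/-- The extension property of the Rado graph. -/
def ExtensionProperty {α : Type*} (R : SimpleGraph α) : Prop :=
  ∀ U W : Finset α, Disjoint U W →
    ∃ v, v ∉ U ∧ v ∉ W ∧ (∀ u ∈ U, R.Adj v u) ∧ ∀ w ∈ W, ¬ R.Adj v w

/-- The set of subdividing vertices of `S(G)`. -/
def subdividers {α : Type*} (G : SimpleGraph α) : Set (α ⊕ G.edgeSet) :=
  Set.range Sum.inr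

/-- Vertex type of `Γ(S(G), A, m)` with `A` the subdividing vertices. -/
abbrev GammaVert {α : Type*} (G : SimpleGraph α) (m : ℕ) :=
  (α ⊕ G.edgeSet) ⊕
    Σ u : subdividers G, Fin (((subdivision G).neighborSet (u : α ⊕ G.edgeSet)).ncard * (m - 1))

/-- `Γ = ⋃_{i} Γ(S(G), A, n i)` with `A` the subdividing vertices of `S(G)`. -/
def bigGamma {α : Type*} (G : SimpleGraph α) {k : ℕ} (n : Fin k → ℕ) :
    SimpleGraph (Σ i : Fin k, GammaVert G (n i)) :=
  sigmaGraph fun i => Gamma (subdivision G) (subdividers G) (n i)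

/-- The set `A_{u,i}` inside `Γ`: the copy of `u` in `Γ_i` together with all its clones. -/
def cloneSet {α : Type*} (G : SimpleGraph α) {k : ℕ} (n : Fin k → ℕ)
    (u : subdividers G) (i : Fin k) : Set (Σ i : Fin k, GammaVert G (n i)) :=
  {p | p = ⟨i, Sum.inl (u : α ⊕ G.edgeSet)⟩ ∨
    ∃ j : Fin (((subdivision G).neighborSet (u : α ⊕ G.edgeSet)).ncard * (n i - 1)),
      p = ⟨i, Sum.inr ⟨u, j⟩⟩}

theorem doubleRay_adj {a b : ℤ} : doubleRay.Adj a b ↔ b = a + 1 ∨ a = b + 1 := by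
  simp only [doubleRay, SimpleGraph.fromRel_adj]
  lia

theorem sumGraph_adj_inl_inl {α β : Type*} {G : SimpleGraph α} {H : SimpleGraph β} {a b : α} :
    (sumGraph G H).Adj (Sum.inl a) (Sum.inl b) ↔ G.Adj a b := by
  simp only [sumGraph, SimpleGraph.fromRel_adj, ne_eq, Sum.inl.injEq]
  exact ⟨fun h => h.2.elim id SimpleGraph.Adj.symm, fun h => ⟨h.ne, Or.inl h⟩⟩

theorem sumGraph_adj_inr_inr {α β : Type*} {G : SimpleGraph α} {H : SimpleGraph β} {a b : β} :
    (sumGraph G H).Adj (Sum.inr a) (Sum.inr b) ↔ H.Adj a b := by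
  simp only [sumGraph, SimpleGraph.fromRel_adj, ne_eq, Sum.inr.injEq]
  exact ⟨fun h => h.2.elim id SimpleGraph.Adj.symm, fun h => ⟨h.ne, Or.inl h⟩⟩

theorem not_sumGraph_adj_inl_inr {α β : Type*} {G : SimpleGraph α} {H : SimpleGraph β}
    {a : α} {b : β} : ¬ (sumGraph G H).Adj (Sum.inl a) (Sum.inr b) := by
  simp [sumGraph, SimpleGraph.fromRel_adj]

theorem not_sumGraph_adj_inr_inl {α β : Type*} {G : SimpleGraph α} {H : SimpleGraph β}
    {a : α} {b : β} : ¬ (sumGraph G H).Adj (Sum.inr b) (Sum.inl a) := by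
  simp [sumGraph, SimpleGraph.fromRel_adj]

/-- The inclusion of one of the two summands of `ℤ ⊕ ℤ`. -/
def summandInclusion : Bool → ℤ → ℤ ⊕ ℤ
  | true => Sum.inl
  | false => Sum.inr

theorem summandInclusion_injective (t : Bool) : Function.Injective (summandInclusion t) := by
  cases t
  · exact Sum.inr_injective
  · exact Sum.inl_injective

theorem sumGraph_adj_summandInclusion (t : Bool) {a b : ℤ} :
    (sumGraph doubleRay doubleRay).Adj (summandInclusion t a) (summandInclusion t b) ↔
      doubleRay.Adj a b := by
  cases t
  · exact sumGraph_adj_inr_inr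
  · exact sumGraph_adj_inl_inl

/-- Adjacent vertices of the disjoint union of two double rays lie in the same summand. -/
theorem exists_eq_summandInclusion_of_adj {t : Bool} {a : ℤ} {y : ℤ ⊕ ℤ}
    (h : (sumGraph doubleRay doubleRay).Adj (summandInclusion t a) y) :
    ∃ b, y = summandInclusion t b := by
  rcases t with _ | _ <;> rcases y with b | b
  · exact (not_sumGraph_adj_inr_inl h).elim
  · exact ⟨b, rfl⟩
  · exact ⟨b, rfl⟩
  · exact (not_sumGraph_adj_inl_inr h).elim

theorem exists_eq_summandInclusion (x : ℤ ⊕ ℤ) : ∃ t a, x = summandInclusion t a := by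
  rcases x with a | a
  · exact ⟨true, a, rfl⟩
  · exact ⟨false, a, rfl⟩

/-- An injective endomorphism of the double ray is surjective on edges. -/
theorem doubleRay_exists_edge_eq {g : ℤ → ℤ} (hg : Function.Injective g)
    (hadj : ∀ n, doubleRay.Adj (g n) (g (n + 1))) (k : ℤ) :
    ∃ n, s(g n, g (n + 1)) = s(k, k + 1) := by
  simp only [doubleRay_adj] at hadj
  have hstep (n : ℤ) : g (n + 1 + 1) - g (n + 1) = g (n + 1) - g n := by
    have hne : g (n + 1 + 1) ≠ g n := hg.ne (by lia)
    have h₁ := hadj n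
    have h₂ := hadj (n + 1)
    lia
  have hconst (n : ℤ) : g (n + 1) - g n = g 1 - g 0 := by
    induction n using Int.induction_on with
    | zero => simp
    | succ i ih => rw [hstep, ih]
    | pred i ih =>
      have h := hstep (-(i : ℤ) - 1)
      rw [sub_add_cancel] at h
      rw [sub_add_cancel, ← h, ih]
  have hlin (n : ℤ) : g n = g 0 + n * (g 1 - g 0) := by
    induction n using Int.induction_on with
    | zero => simp
    | succ i ih => linear_combination ih + hconst i
    | pred i ih =>
      have h := hconst (-(i : ℤ) - 1)
      rw [sub_add_cancel] at h
      linear_combination ih - h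
  rcases hadj 0 with h | h <;> rw [zero_add] at h
  · refine ⟨k - g 0, ?_⟩
    have h₀ : g (k - g 0) = k := by rw [hlin, h]; ring
    have h₁ : g (k - g 0 + 1) = k + 1 := by rw [hlin, h]; ring
    rw [h₀, h₁]
  · refine ⟨g 0 - k - 1, ?_⟩
    have h₀ : g (g 0 - k - 1) = k + 1 := by rw [hlin, h]; ring
    have h₁ : g (g 0 - k - 1 + 1) = k := by rw [hlin, h]; ring
    rw [h₀, h₁, Sym2.eq_swap]

/-- A double ray in the disjoint union of two double rays contains every edge of one of them. -/
theorem exists_summand_forall_exists_edge_eq {f : ℤ → ℤ ⊕ ℤ} (hf : Function.Injective f)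
    (hadj : ∀ n, (sumGraph doubleRay doubleRay).Adj (f n) (f (n + 1))) :
    ∃ t, ∀ k, ∃ n,
      s(f n, f (n + 1)) = s(summandInclusion t k, summandInclusion t (k + 1)) := by
  obtain ⟨t, a, ha⟩ := exists_eq_summandInclusion (f 0)
  have hmem (n : ℤ) : ∃ b, f n = summandInclusion t b := by
    induction n using Int.induction_on with
    | zero => exact ⟨a, ha⟩
    | succ i ih =>
      obtain ⟨b, hb⟩ := ih
      exact exists_eq_summandInclusion_of_adj (hb ▸ hadj i)
    | pred i ih =>
      obtain ⟨b, hb⟩ := ih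
      have h := hadj (-(i : ℤ) - 1)
      rw [sub_add_cancel] at h
      exact exists_eq_summandInclusion_of_adj (hb ▸ h.symm)
  choose g hg using hmem
  obtain rfl : f = fun n => summandInclusion t (g n) := funext hg
  refine ⟨t, fun k => ?_⟩
  obtain ⟨n, hn⟩ := doubleRay_exists_edge_eq (g := g)
    (fun x y h => hf (congrArg (summandInclusion t) h))
    (fun n => (sumGraph_adj_summandInclusion t).1 (hadj n)) k
  exact ⟨n, by simpa only [Sym2.map_mk] using congrArg (Sym2.map (summandInclusion t)) hn⟩

/-- A colouring without a blue double ray has a red edge in each summand. -/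
theorem exists_red_edge_of_not_hasMonoCopy {c : Sym2 (ℤ ⊕ ℤ) → Bool}
    (hc : ¬ HasMonoCopy (sumGraph doubleRay doubleRay) c false doubleRay) (t : Bool) :
    ∃ k, c s(summandInclusion t k, summandInclusion t (k + 1)) = true := by
  by_contra! hblue
  refine hc ⟨summandInclusion t, summandInclusion_injective t, fun x y hxy => ?_⟩
  refine ⟨(sumGraph_adj_summandInclusion t).2 hxy, ?_⟩
  rcases doubleRay_adj.1 hxy with rfl | rfl
  · simpa using hblue x
  · rw [Sym2.eq_swap]
    simpa using hblue y

theorem arrows_sumGraph_doubleRay :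
    Arrows (sumGraph doubleRay doubleRay) twoS1 doubleRay := by
  intro c
  by_contra! h
  obtain ⟨hred, hblue⟩ := h
  obtain ⟨k, hk⟩ := exists_red_edge_of_not_hasMonoCopy hblue true
  obtain ⟨l, hl⟩ := exists_red_edge_of_not_hasMonoCopy hblue false
  have hinj (m : ℤ) : Function.Injective fun i : Fin 2 => m + (i : ℤ) := fun i j hij => by
    simpa [Fin.ext_iff] using hij
  have hadj (m : ℤ) {i j : Fin 2} (hij : i ≠ j) :
      doubleRay.Adj (m + (i : ℤ)) (m + (j : ℤ)) ∧
        s(m + (i : ℤ), m + (j : ℤ)) = s(m, m + 1) := by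
    fin_cases i <;> fin_cases j <;> simp_all [doubleRay_adj, Sym2.eq_swap]
  refine hred ⟨Sum.map (fun i : Fin 2 => k + (i : ℤ)) (fun i : Fin 2 => l + (i : ℤ)),
    Sum.map_injective.2 ⟨hinj k, hinj l⟩, ?_⟩
  rintro (i | i) (j | j) hij
  · obtain ⟨h₁, h₂⟩ := hadj k (sumGraph_adj_inl_inl.1 hij).ne
    refine ⟨sumGraph_adj_inl_inl.2 h₁, ?_⟩
    rw [← hk]
    exact congrArg (fun e => c (Sym2.map Sum.inl e)) h₂
  · exact (not_sumGraph_adj_inl_inr hij).elim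
  · exact (not_sumGraph_adj_inr_inl hij).elim
  · obtain ⟨h₁, h₂⟩ := hadj l (sumGraph_adj_inr_inr.1 hij).ne
    refine ⟨sumGraph_adj_inr_inr.2 h₁, ?_⟩
    rw [← hl]
    exact congrArg (fun e => c (Sym2.map Sum.inr e)) h₂

/-- A colouring with at most one red edge has no red `2S₁`. -/
theorem not_hasMonoCopy_twoS1 {α : Type*} {F : SimpleGraph α} {c : Sym2 α → Bool}
    (hc : ∀ e e', c e = true → c e' = true → e = e') : ¬ HasMonoCopy F c true twoS1 := by
  rintro ⟨f, hf, hadj⟩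
  have h₁ := (hadj (sumGraph_adj_inl_inl.2 (zero_ne_one (α := Fin 2)) :
    twoS1.Adj (Sum.inl 0) (Sum.inl 1))).2
  have h₂ := (hadj (sumGraph_adj_inr_inr.2 (zero_ne_one (α := Fin 2)) :
    twoS1.Adj (Sum.inr 0) (Sum.inr 1))).2
  have h := hc _ _ h₁ h₂
  simp [hf.eq_iff] at h

theorem exists_missing_edge {F' : (sumGraph doubleRay doubleRay).Subgraph} (hF' : F' ≠ ⊤) :
    ∃ t k, ¬ F'.Adj (summandInclusion t k) (summandInclusion t (k + 1)) := by
  by_contra! h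
  refine hF' (SimpleGraph.Subgraph.ext ?_ ?_)
  · refine Set.eq_univ_of_forall fun x => ?_
    obtain ⟨t, a, rfl⟩ := exists_eq_summandInclusion x
    exact (h t a).fst_mem
  · ext x y
    refine ⟨fun hxy => hxy.adj_sub, fun hxy => ?_⟩
    rw [SimpleGraph.Subgraph.top_adj] at hxy
    obtain ⟨t, a, rfl⟩ := exists_eq_summandInclusion x
    obtain ⟨b, rfl⟩ := exists_eq_summandInclusion_of_adj hxy
    rcases doubleRay_adj.1 ((sumGraph_adj_summandInclusion t).1 hxy) with rfl | rfl
    · exact h t a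
    · exact (h t b).symm

/-- `2ℤ` is `(2S₁, ℤ)`-minimal. -/
theorem stmt_12 : IsRamseyMinimal (sumGraph doubleRay doubleRay) twoS1 doubleRay := by
  refine ⟨arrows_sumGraph_doubleRay, fun F' hF' harrows => ?_⟩
  obtain ⟨t, k, hmissing⟩ := exists_missing_edge hF'
  let r : Sym2 (ℤ ⊕ ℤ) := s(summandInclusion (!t) 0, summandInclusion (!t) (0 + 1))
  rcases harrows fun e => decide (e.map Subtype.val = r) with hred | ⟨f, hf, hadj⟩
  · refine not_hasMonoCopy_twoS1 (fun e e' he he' => ?_) hred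
    exact Sym2.map.injective Subtype.val_injective
      ((of_decide_eq_true he).trans (of_decide_eq_true he').symm)
  · have hray (n : ℤ) := hadj (doubleRay_adj.2 (Or.inl rfl) : doubleRay.Adj n (n + 1))
    obtain ⟨t', ht'⟩ := exists_summand_forall_exists_edge_eq
      (f := fun n => (f n : ℤ ⊕ ℤ)) (Subtype.val_injective.comp hf)
      (fun n => F'.adj_sub (hray n).1)
    rcases Bool.eq_or_eq_not t' t with rfl | rfl
    · obtain ⟨n, hn⟩ := ht' k
      have hmem : s((f n : ℤ ⊕ ℤ), (f (n + 1) : ℤ ⊕ ℤ)) ∈ F'.edgeSet := (hray n).1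
      rw [hn] at hmem
      exact hmissing hmem
    · obtain ⟨n, hn⟩ := ht' 0
      exact of_decide_eq_false (hray n).2 hn
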